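/- arXiv:2506.23619 — 6 statements merged into one kernel-verified Lean document; each statement's English description precedes it below -/
import Mathlib

section
/- Fix z > 0, τ > 0 with z ≥ τ, and vectors β_is, β_oos ∈ ℝ^p. For matrices Σ̂, Σ ∈ ℝ^{p×p} with Σ̂ symmetric positive semidefinite, define F(Σ̂, Σ) = −z·β_oosᵀ Σ (Σ̂ + zI)⁻¹ β_is. Then: (a) for any Σ₁, Σ₂ and symmetric positive semidefinite Σ̂, |F(Σ̂, Σ₁) − F(Σ̂, Σ₂)| ≤ ‖β_is‖·‖β_oos‖·‖Σ₁ − Σ₂‖_op; (b) for any Σ with ‖Σ‖_op ≤ τ⁻¹ and symmetric positive semidefinite Σ̂₁, Σ̂₂, |F(Σ̂₁, Σ) − F(Σ̂₂, Σ)| ≤ τ⁻²·‖β_is‖·‖β_oos‖·‖Σ̂₁ − Σ̂₂‖_op; (c) consequently, with C = max{‖β_is‖‖β_oos‖, τ⁻²‖β_is‖‖β_oos‖}, Σ̂₁ = n⁻¹X₁ᵀX₁ and Σ̂₂ = n⁻¹X₂ᵀX₂ for n×p matrices X₁, X₂, and ‖Σ₂‖_op ≤ τ⁻¹: |F(Σ̂₁,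 Σ₁) − F(Σ̂₂, Σ₂)| ≤ C·‖Σ₁ − Σ₂‖_op + (C/n)·‖X₁ − X₂‖_op·(‖X₁‖_op + ‖X₂‖_op). -/
open Matrix

/-- The ℓ²→ℓ² operator norm (largest singular value) of a real matrix. -/
noncomputable def l2OpNorm {m n : ℕ} (A : Matrix (Fin m) (Fin n) ℝ) : ℝ :=
  ‖LinearMap.toContinuousLinearMap (Matrix.toEuclideanLin A)‖

section L2Operator

open scoped Matrix.Norms.L2Operator

theorem l2OpNorm_eq_norm {m n : ℕ} (A : Matrix (Fin m) (Fin n) ℝ) : l2OpNorm A = ‖A‖ := by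
  rw [Matrix.l2_opNorm_def]
  rfl

theorem l2OpNorm_nonneg {m n : ℕ} (A : Matrix (Fin m) (Fin n) ℝ) : 0 ≤ l2OpNorm A :=
  norm_nonneg _

theorem l2OpNorm_mul_le {l m n : ℕ} (A : Matrix (Fin l) (Fin m) ℝ) (B : Matrix (Fin m) (Fin n) ℝ) :
    l2OpNorm (A * B) ≤ l2OpNorm A * l2OpNorm B := by
  simpa only [l2OpNorm_eq_norm] using Matrix.l2_opNorm_mul A B

theorem l2OpNorm_transpose {m n : ℕ} (A : Matrix (Fin m) (Fin n) ℝ) :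
    l2OpNorm Aᵀ = l2OpNorm A := by
  rw [l2OpNorm_eq_norm, l2OpNorm_eq_norm, ← Matrix.conjTranspose_eq_transpose_of_trivial,
    Matrix.l2_opNorm_conjTranspose]

theorem l2OpNorm_gram_sub_gram_le {m n : ℕ} (A B : Matrix (Fin m) (Fin n) ℝ) :
    l2OpNorm (Aᵀ * A - Bᵀ * B) ≤ l2OpNorm (A - B) * (l2OpNorm A + l2OpNorm B) := by
  have h : Aᵀ * A - Bᵀ * B = Aᵀ * (A - B) + (A - B)ᵀ * B := by
    rw [Matrix.transpose_sub, Matrix.mul_sub, Matrix.sub_mul]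
    abel
  have hadd : l2OpNorm (Aᵀ * (A - B) + (A - B)ᵀ * B) ≤
      l2OpNorm (Aᵀ * (A - B)) + l2OpNorm ((A - B)ᵀ * B) := by
    simpa only [l2OpNorm_eq_norm] using norm_add_le (Aᵀ * (A - B)) ((A - B)ᵀ * B)
  have h₁ := l2OpNorm_mul_le Aᵀ (A - B)
  have h₂ := l2OpNorm_mul_le (A - B)ᵀ B
  rw [l2OpNorm_transpose] at h₁ h₂
  rw [h]
  linarith

theorem l2OpNorm_smul {m n : ℕ} (c : ℝ) (A : Matrix (Fin m) (Fin n) ℝ) :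
    l2OpNorm (c • A) = |c| * l2OpNorm A := by
  rw [l2OpNorm_eq_norm, l2OpNorm_eq_norm, norm_smul, Real.norm_eq_abs]

end L2Operator

theorem EuclideanSpace.norm_toLp_eq_sqrt {n : ℕ} (v : Fin n → ℝ) :
    ‖WithLp.toLp 2 v‖ = Real.sqrt (∑ i, (v i) ^ 2) := by
  simp [EuclideanSpace.norm_eq]

theorem abs_dotProduct_mulVec_le {m n : ℕ} (A : Matrix (Fin m) (Fin n) ℝ)
    (x : Fin m → ℝ) (y : Fin n → ℝ) :
    |x ⬝ᵥ (A *ᵥ y)| ≤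
      Real.sqrt (∑ i, (y i) ^ 2) * Real.sqrt (∑ i, (x i) ^ 2) * l2OpNorm A := by
  rw [← EuclideanSpace.norm_toLp_eq_sqrt, ← EuclideanSpace.norm_toLp_eq_sqrt]
  have hA : ‖WithLp.toLp 2 (A *ᵥ y)‖ ≤ l2OpNorm A * ‖WithLp.toLp 2 y‖ :=
    (LinearMap.toContinuousLinearMap (Matrix.toEuclideanLin A)).le_opNorm (WithLp.toLp 2 y)
  have hxy := abs_real_inner_le_norm (WithLp.toLp 2 (A *ᵥ y)) (WithLp.toLp 2 x)
  rw [EuclideanSpace.inner_toLp_toLp, star_trivial] at hxy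
  calc _ ≤ _ := hxy
    _ ≤ l2OpNorm A * ‖WithLp.toLp 2 y‖ * ‖WithLp.toLp 2 x‖ := by gcongr
    _ = _ := by ring

theorem Matrix.PosSemidef.isUnit_det_add_smul_one {n : ℕ} {A : Matrix (Fin n) (Fin n) ℝ}
    (hA : A.PosSemidef) {z : ℝ} (hz : 0 < z) : IsUnit (A + z • 1).det :=
  (Matrix.isUnit_iff_isUnit_det _).1
    (Matrix.PosDef.posSemidef_add hA (Matrix.PosDef.one.smul hz)).isUnit

theorem l2OpNorm_resolvent_le {n : ℕ} {A : Matrix (Fin n) (Fin n) ℝ}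
    (hA : A.PosSemidef) {z : ℝ} (hz : 0 < z) : l2OpNorm (A + z • 1)⁻¹ ≤ z⁻¹ := by
  refine ContinuousLinearMap.opNorm_le_bound _ (inv_nonneg.2 hz.le) fun x => ?_
  set y : Fin n → ℝ := (A + z • 1)⁻¹ *ᵥ x.ofLp with hy
  change ‖WithLp.toLp 2 y‖ ≤ z⁻¹ * ‖x‖
  have hx : x.ofLp = A *ᵥ y + z • y := by
    have h : (A + z • 1) *ᵥ y = x.ofLp := by
      rw [hy, Matrix.mulVec_mulVec, Matrix.mul_nonsing_inv _ (hA.isUnit_det_add_smul_one hz),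
        Matrix.one_mulVec]
    rw [← h, Matrix.add_mulVec, Matrix.smul_mulVec, Matrix.one_mulVec]
  have hAy : 0 ≤ y ⬝ᵥ (A *ᵥ y) := by simpa using hA.dotProduct_mulVec_nonneg y
  have hyy : y ⬝ᵥ y = ‖WithLp.toLp 2 y‖ ^ 2 := by
    rw [← real_inner_self_eq_norm_sq, EuclideanSpace.inner_toLp_toLp, star_trivial]
  have hyx : y ⬝ᵥ x.ofLp ≤ ‖x‖ * ‖WithLp.toLp 2 y‖ := by
    have h := real_inner_le_norm x (WithLp.toLp 2 y)
    rwa [EuclideanSpace.inner_eq_star_dotProduct, star_trivial] at h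
  rw [hx, dotProduct_add, dotProduct_smul, smul_eq_mul, hyy] at hyx
  rw [inv_mul_eq_div, le_div_iff₀ hz]
  rcases (norm_nonneg (WithLp.toLp 2 y)).eq_or_lt with h0 | hpos
  · rw [← h0, zero_mul]
    exact norm_nonneg x
  · refine le_of_mul_le_mul_right ?_ hpos
    nlinarith

theorem l2OpNorm_resolvent_sub_le {n : ℕ} {A B : Matrix (Fin n) (Fin n) ℝ}
    (hA : A.PosSemidef) (hB : B.PosSemidef) {z : ℝ} (hz : 0 < z) :
    l2OpNorm ((A + z • 1)⁻¹ - (B + z • 1)⁻¹) ≤ z⁻¹ * l2OpNorm (A - B) * z⁻¹ := by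
  have h : (A + z • 1)⁻¹ - (B + z • 1)⁻¹ =
      -1 • ((A + z • 1)⁻¹ * (A - B) * (B + z • 1)⁻¹) := by
    rw [show A - B = (A + z • 1) - (B + z • 1) by abel, Matrix.mul_sub, Matrix.sub_mul,
      Matrix.nonsing_inv_mul _ (hA.isUnit_det_add_smul_one hz), Matrix.one_mul, Matrix.mul_assoc,
      Matrix.mul_nonsing_inv _ (hB.isUnit_det_add_smul_one hz), Matrix.mul_one]
    abel
  rw [h, neg_one_smul, ← neg_one_smul ℝ, l2OpNorm_smul, abs_neg, abs_one, one_mul]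
  have hz' := inv_pos.2 hz
  calc _ ≤ l2OpNorm ((A + z • 1)⁻¹ * (A - B)) * l2OpNorm (B + z • 1)⁻¹ := l2OpNorm_mul_le _ _
    _ ≤ l2OpNorm (A + z • 1)⁻¹ * l2OpNorm (A - B) * l2OpNorm (B + z • 1)⁻¹ :=
      mul_le_mul_of_nonneg_right (l2OpNorm_mul_le _ _) (l2OpNorm_nonneg _)
    _ ≤ _ := by
      have := l2OpNorm_nonneg (A - B)
      have := l2OpNorm_nonneg (B + z • 1)⁻¹
      gcongr
      · exact l2OpNorm_resolvent_le hA hz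
      · exact l2OpNorm_resolvent_le hB hz

/-- Lipschitz-type perturbation bounds (Eq. (ineqlipschitz)) for the resolvent
bilinear form `F(Σ̂, Σ) = −z·β_oosᵀ Σ (Σ̂ + zI)⁻¹ β_is`. -/
theorem resolvent_bilinear_form_perturbation_bounds
    {p : ℕ} (z τ : ℝ) (hτ : 0 < τ) (hz : τ ≤ z)
    (βis βoos : Fin p → ℝ)
    (F : Matrix (Fin p) (Fin p) ℝ → Matrix (Fin p) (Fin p) ℝ → ℝ)
    (hF : F = fun Shat S =>
      -z * (βoos ⬝ᵥ ((S * (Shat + z • 1)⁻¹) *ᵥ βis))) :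
    -- (a) Lipschitz in the population covariance
    (∀ (S₁ S₂ Shat : Matrix (Fin p) (Fin p) ℝ), Shat.PosSemidef →
      |F Shat S₁ - F Shat S₂| ≤
        Real.sqrt (∑ i, (βis i) ^ 2) * Real.sqrt (∑ i, (βoos i) ^ 2) *
          l2OpNorm (S₁ - S₂)) ∧
    -- (b) Lipschitz in the sample covariance
    (∀ (S Shat₁ Shat₂ : Matrix (Fin p) (Fin p) ℝ),
      l2OpNorm S ≤ τ⁻¹ → Shat₁.PosSemidef → Shat₂.PosSemidef →
      |F Shat₁ S - F Shat₂ S| ≤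
        τ⁻¹ ^ 2 * (Real.sqrt (∑ i, (βis i) ^ 2) * Real.sqrt (∑ i, (βoos i) ^ 2)) *
          l2OpNorm (Shat₁ - Shat₂)) ∧
    -- (c) combined bound for Gram sample covariances
    (∀ (C : ℝ), C = max (Real.sqrt (∑ i, (βis i) ^ 2) * Real.sqrt (∑ i, (βoos i) ^ 2))
        (τ⁻¹ ^ 2 * (Real.sqrt (∑ i, (βis i) ^ 2) * Real.sqrt (∑ i, (βoos i) ^ 2))) →
      ∀ (n : ℕ) (X₁ X₂ : Matrix (Fin n) (Fin p) ℝ)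
        (S₁ S₂ : Matrix (Fin p) (Fin p) ℝ), l2OpNorm S₂ ≤ τ⁻¹ →
      |F ((n : ℝ)⁻¹ • (X₁ᵀ * X₁)) S₁ - F ((n : ℝ)⁻¹ • (X₂ᵀ * X₂)) S₂| ≤
        C * l2OpNorm (S₁ - S₂) +
          C / n * (l2OpNorm (X₁ - X₂) * (l2OpNorm X₁ + l2OpNorm X₂))) := by
  have hz0 : 0 < z := hτ.trans_le hz
  have ha : ∀ (S₁ S₂ Shat : Matrix (Fin p) (Fin p) ℝ), Shat.PosSemidef →
      |F Shat S₁ - F Shat S₂| ≤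
        Real.sqrt (∑ i, (βis i) ^ 2) * Real.sqrt (∑ i, (βoos i) ^ 2) *
          l2OpNorm (S₁ - S₂) := by
    intro S₁ S₂ Shat hS
    have h : F Shat S₁ - F Shat S₂ =
        -z * (βoos ⬝ᵥ (((S₁ - S₂) * (Shat + z • 1)⁻¹) *ᵥ βis)) := by
      simp only [hF, Matrix.sub_mul, Matrix.sub_mulVec, dotProduct_sub]
      ring
    rw [h, abs_mul, abs_neg, abs_of_pos hz0]
    have hR : l2OpNorm ((S₁ - S₂) * (Shat + z • 1)⁻¹) ≤ l2OpNorm (S₁ - S₂) * z⁻¹ :=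
      (l2OpNorm_mul_le _ _).trans
        (mul_le_mul_of_nonneg_left (l2OpNorm_resolvent_le hS hz0) (l2OpNorm_nonneg _))
    calc _ ≤ z * (Real.sqrt (∑ i, (βis i) ^ 2) * Real.sqrt (∑ i, (βoos i) ^ 2) *
          (l2OpNorm (S₁ - S₂) * z⁻¹)) := by
          refine mul_le_mul_of_nonneg_left ((abs_dotProduct_mulVec_le _ _ _).trans ?_) hz0.le
          gcongr
      _ = _ := by field_simp
  have hb : ∀ (S Shat₁ Shat₂ : Matrix (Fin p) (Fin p) ℝ),
      l2OpNorm S ≤ τ⁻¹ → Shat₁.PosSemidef → Shat₂.PosSemidef →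
      |F Shat₁ S - F Shat₂ S| ≤
        τ⁻¹ ^ 2 * (Real.sqrt (∑ i, (βis i) ^ 2) * Real.sqrt (∑ i, (βoos i) ^ 2)) *
          l2OpNorm (Shat₁ - Shat₂) := by
    intro S A B hS hA hB
    have h : F A S - F B S =
        -z * (βoos ⬝ᵥ ((S * ((A + z • 1)⁻¹ - (B + z • 1)⁻¹)) *ᵥ βis)) := by
      simp only [hF, Matrix.mul_sub, Matrix.sub_mulVec, dotProduct_sub]
      ring
    rw [h, abs_mul, abs_neg, abs_of_pos hz0]
    have hN := l2OpNorm_nonneg (A - B)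
    have hR : l2OpNorm (S * ((A + z • 1)⁻¹ - (B + z • 1)⁻¹)) ≤
        τ⁻¹ * (z⁻¹ * l2OpNorm (A - B) * z⁻¹) :=
      (l2OpNorm_mul_le _ _).trans
        (mul_le_mul hS (l2OpNorm_resolvent_sub_le hA hB hz0) (l2OpNorm_nonneg _)
          (inv_pos.2 hτ).le)
    calc _ ≤ z * (Real.sqrt (∑ i, (βis i) ^ 2) * Real.sqrt (∑ i, (βoos i) ^ 2) *
          (τ⁻¹ * (z⁻¹ * l2OpNorm (A - B) * z⁻¹))) := by
          refine mul_le_mul_of_nonneg_left ((abs_dotProduct_mulVec_le _ _ _).trans ?_) hz0.le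
          gcongr
      _ = τ⁻¹ * z⁻¹ * (Real.sqrt (∑ i, (βis i) ^ 2) * Real.sqrt (∑ i, (βoos i) ^ 2)) *
          l2OpNorm (A - B) := by field_simp
      _ ≤ τ⁻¹ * τ⁻¹ * (Real.sqrt (∑ i, (βis i) ^ 2) * Real.sqrt (∑ i, (βoos i) ^ 2)) *
          l2OpNorm (A - B) := by gcongr
      _ = _ := by ring
  refine ⟨ha, hb, ?_⟩
  intro C hC n X₁ X₂ S₁ S₂ hS₂
  have hn : (0 : ℝ) ≤ (n : ℝ)⁻¹ := by positivity
  have hpos : ∀ X : Matrix (Fin n) (Fin p) ℝ, ((n : ℝ)⁻¹ • (Xᵀ * X)).PosSemidef := fun X => by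
    rw [← Matrix.conjTranspose_eq_transpose_of_trivial]
    exact (Matrix.posSemidef_conjTranspose_mul_self X).smul hn
  have hC₁ : Real.sqrt (∑ i, (βis i) ^ 2) * Real.sqrt (∑ i, (βoos i) ^ 2) ≤ C :=
    hC ▸ le_max_left _ _
  have hC₂ : τ⁻¹ ^ 2 * (Real.sqrt (∑ i, (βis i) ^ 2) * Real.sqrt (∑ i, (βoos i) ^ 2)) ≤ C :=
    hC ▸ le_max_right _ _
  have hC₀ : 0 ≤ C := le_trans (by positivity) hC₁
  have hG : l2OpNorm ((n : ℝ)⁻¹ • (X₁ᵀ * X₁) - (n : ℝ)⁻¹ • (X₂ᵀ * X₂)) ≤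
      (n : ℝ)⁻¹ * (l2OpNorm (X₁ - X₂) * (l2OpNorm X₁ + l2OpNorm X₂)) := by
    rw [← smul_sub, l2OpNorm_smul, abs_of_nonneg hn]
    exact mul_le_mul_of_nonneg_left (l2OpNorm_gram_sub_gram_le X₁ X₂) hn
  calc _ ≤ _ := abs_sub_le _ (F ((n : ℝ)⁻¹ • (X₁ᵀ * X₁)) S₂) _
    _ ≤ _ := add_le_add (ha S₁ S₂ _ (hpos X₁)) (hb S₂ _ _ hS₂ (hpos X₁) (hpos X₂))
    _ ≤ C * l2OpNorm (S₁ - S₂) +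
        C * ((n : ℝ)⁻¹ * (l2OpNorm (X₁ - X₂) * (l2OpNorm X₁ + l2OpNorm X₂))) :=
      add_le_add (mul_le_mul_of_nonneg_right hC₁ (l2OpNorm_nonneg _))
        (mul_le_mul hC₂ hG (l2OpNorm_nonneg _) hC₀)
    _ = _ := by ring
end

section
/- For c > 0 and z > 0, define m(z; c) = (c − 1 − z + √((1 − c + z)² + 4cz)) / (2cz) and f(z; c) = 1 − z / (z·(1 + c·m(z; c)) + 1 − c). Then the denominator z·(1 + c·m(z; c)) + 1 − c is strictly positive and 0 < f(z; c) < 1 (in particular f(z; c) ∈ [0, 1)). -/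
/-- The limiting expected-return coefficient
`f(z; c) = 1 − z/(z(1 + c·m(z;c)) + 1 − c)` is well defined (its denominator is
strictly positive) and lies in `(0, 1)` (in particular in `[0, 1)`). -/
theorem limiting_return_coefficient_mem_Ioo (c z : ℝ) (hc : 0 < c) (hz : 0 < z)
    (m f : ℝ)
    (hm : m = (c - 1 - z + Real.sqrt ((1 - c + z) ^ 2 + 4 * c * z)) / (2 * c * z))
    (hf : f = 1 - z / (z * (1 + c * m) + 1 - c)) :
    0 < z * (1 + c * m) + 1 - c ∧ 0 < f ∧ f < 1 := by
  have hD : z * (1 + c * m) + 1 - c =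
      (z + 1 - c + Real.sqrt ((1 - c + z) ^ 2 + 4 * c * z)) / 2 := by
    rw [hm]
    field_simp
    ring
  have hlt : z + c - 1 < Real.sqrt ((1 - c + z) ^ 2 + 4 * c * z) :=
    Real.lt_sqrt_of_sq_lt (by nlinarith)
  have hzD : z < z * (1 + c * m) + 1 - c := by
    rw [hD]
    linarith
  have hpos : 0 < z * (1 + c * m) + 1 - c := hz.trans hzD
  refine ⟨hpos, ?_, ?_⟩
  · rw [hf, sub_pos, div_lt_one hpos]
    exact hzD
  · rw [hf]
    exact sub_lt_self 1 (div_pos hz hpos)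
end

section
/- For c > 0 and z > 0, define m(z; c) = (c − 1 − z + √((1 − c + z)² + 4cz)) / (2cz) and f(z; c) = 1 − z / (z·(1 + c·m(z; c)) + 1 − c). Then for every fixed c > 0 the function z ↦ f(z; c) is strictly decreasing on (0, ∞). Consequently, for fixed vectors β_is, β_oos ∈ ℝ^p, the map z ↦ f(z; c)·⟨β_is, β_oos⟩ is monotone decreasing in z when ⟨β_is, β_oos⟩ ≥ 0 and monotone increasing when ⟨β_is, β_oos⟩ ≤ 0. -/
theorem sqrt_discriminant_sub_id_strictMonoOn {c : ℝ} (hc : 0 < c) :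
    StrictMonoOn (fun z => Real.sqrt ((1 - c + z) ^ 2 + 4 * c * z) - z) (Set.Ioi (0 : ℝ)) := by
  intro x hx y hy hxy
  simp only [Set.mem_Ioi] at hx hy
  have hR : Real.sqrt ((1 - c + x) ^ 2 + 4 * c * x) < x + 1 + c := by
    rw [Real.sqrt_lt' (by positivity)]
    linarith
  have hsq : Real.sqrt ((1 - c + x) ^ 2 + 4 * c * x) ^ 2 = (1 - c + x) ^ 2 + 4 * c * x :=
    Real.sq_sqrt (by positivity)
  have h : Real.sqrt ((1 - c + x) ^ 2 + 4 * c * x) + (y - x) <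
      Real.sqrt ((1 - c + y) ^ 2 + 4 * c * y) := by
    apply Real.lt_sqrt_of_sq_lt
    nlinarith [mul_pos (sub_pos.2 hxy) (sub_pos.2 hR)]
  dsimp only
  linarith

theorem one_sub_div_eq_sqrt_discriminant {c z : ℝ} (hc : 0 < c) (hz : 0 < z) :
    1 - z / (z * (1 + c * ((c - 1 - z + Real.sqrt ((1 - c + z) ^ 2 + 4 * c * z)) /
      (2 * c * z))) + 1 - c) =
      1 - (Real.sqrt ((1 - c + z) ^ 2 + 4 * c * z) - z - 1 + c) / (2 * c) := by
  have hcz : 0 < c * z := mul_pos hc hz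
  have hsq : Real.sqrt ((1 - c + z) ^ 2 + 4 * c * z) ^ 2 = (1 - c + z) ^ 2 + 4 * c * z :=
    Real.sq_sqrt (by positivity)
  have habs : |1 - c + z| < Real.sqrt ((1 - c + z) ^ 2 + 4 * c * z) := by
    apply Real.lt_sqrt_of_sq_lt
    rw [sq_abs]
    linarith
  generalize Real.sqrt ((1 - c + z) ^ 2 + 4 * c * z) = R at *
  have hpos : 0 < 1 - c + z + R := by linarith [neg_abs_le (1 - c + z)]
  have hD : z * (1 + c * ((c - 1 - z + R) / (2 * c * z))) + 1 - c = (1 - c + z + R) / 2 := by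
    field_simp
    ring
  rw [hD]
  congr 1
  rw [div_eq_div_iff (by positivity) (by positivity)]
  linarith

/-- Monotonicity of the limiting expected return in the ridge penalty
(last assertion of Proposition 4): `z ↦ f(z; c)` is strictly decreasing on
`(0, ∞)`, hence `z ↦ f(z; c)·⟨β_is, β_oos⟩` is monotone decreasing when
`⟨β_is, β_oos⟩ ≥ 0` and monotone increasing when `⟨β_is, β_oos⟩ ≤ 0`. -/
theorem limiting_return_coefficient_monotonicity (c : ℝ) (hc : 0 < c)
    (m f : ℝ → ℝ)
    (hm : ∀ z, m z = (c - 1 - z + Real.sqrt ((1 - c + z) ^ 2 + 4 * c * z)) /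
        (2 * c * z))
    (hf : ∀ z, f z = 1 - z / (z * (1 + c * m z) + 1 - c)) :
    StrictAntiOn f (Set.Ioi (0 : ℝ)) ∧
    (∀ {p : ℕ} (βis βoos : Fin p → ℝ),
      (0 ≤ ∑ i, βis i * βoos i →
        AntitoneOn (fun z => f z * ∑ i, βis i * βoos i) (Set.Ioi (0 : ℝ))) ∧
      (∑ i, βis i * βoos i ≤ 0 →
        MonotoneOn (fun z => f z * ∑ i, βis i * βoos i) (Set.Ioi (0 : ℝ)))) := by
  have hanti : StrictAntiOn f (Set.Ioi (0 : ℝ)) := by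
    intro x hx y hy hxy
    have h := sqrt_discriminant_sub_id_strictMonoOn hc hx hy hxy
    rw [hf, hf, hm, hm, one_sub_div_eq_sqrt_discriminant hc hx,
      one_sub_div_eq_sqrt_discriminant hc hy]
    gcongr
  refine ⟨hanti, fun βis βoos => ⟨fun h x hx y hy hxy => ?_, fun h x hx y hy hxy => ?_⟩⟩
  · exact mul_le_mul_of_nonneg_right (hanti.antitoneOn hx hy hxy) h
  · exact mul_le_mul_of_nonpos_right (hanti.antitoneOn hx hy hxy) h
end

section
/- For c > 0 and z > 0, define m(z; c) = (c − 1 − z + √((1 − c + z)² + 4cz)) / (2cz) and f(z; c) = 1 − z / (z·(1 + c·m(z; c)) + 1 − c). Then: (i) if 0 < c < 1, lim_{z → 0⁺} f(z; c) = 1; and (ii) if c > 1, lim_{z → 0⁺} f(z; c) = 1/c. In other words, the ridgeless limit of f(z; c) equals f(c) = 1 − ((c − 1)/c)·1_{c > 1}. -/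
open Filter Topology

/-- Rationalized form of the limiting return coefficient, free of division by `z`. -/
lemma return_coefficient_eq_rationalized {c z : ℝ} (hc : 0 < c) (hz : 0 < z) :
    1 - z / (z * (1 + c * ((c - 1 - z + Real.sqrt ((1 - c + z) ^ 2 + 4 * c * z)) /
        (2 * c * z))) + 1 - c) =
      1 - (Real.sqrt ((1 - c + z) ^ 2 + 4 * c * z) - (1 - c + z)) / (2 * c) := by
  have hcz : 0 < c * z := mul_pos hc hz
  have hS := Real.sq_sqrt (show 0 ≤ (1 - c + z) ^ 2 + 4 * c * z by positivity)
  have hlt : |1 - c + z| < Real.sqrt ((1 - c + z) ^ 2 + 4 * c * z) :=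
    Real.lt_sqrt_of_sq_lt (by rw [sq_abs]; linarith)
  set S := Real.sqrt ((1 - c + z) ^ 2 + 4 * c * z)
  have hD : z * (1 + c * ((c - 1 - z + S) / (2 * c * z))) + 1 - c = (1 - c + z + S) / 2 := by
    field_simp
    ring
  have hpos : 0 < 1 - c + z + S := by linarith [neg_abs_le (1 - c + z)]
  rw [hD, sub_right_inj, div_eq_div_iff (by positivity) (by positivity)]
  linear_combination -hS / 2

/-- Ridgeless limit of the limiting expected-return coefficient
(Proposition 12, Eq. (isotropicridgeless)): as `z → 0⁺`, `f(z; c)` tends to `1`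
when `c < 1` and to `1/c` when `c > 1`; i.e. the limit is
`f(c) = 1 − ((c−1)/c)·1_{c>1}`. -/
theorem limiting_return_coefficient_ridgeless_limit (c : ℝ) (hc : 0 < c)
    (m f : ℝ → ℝ)
    (hm : ∀ z, m z = (c - 1 - z + Real.sqrt ((1 - c + z) ^ 2 + 4 * c * z)) /
        (2 * c * z))
    (hf : ∀ z, f z = 1 - z / (z * (1 + c * m z) + 1 - c)) :
    (c < 1 → Tendsto f (𝓝[>] (0 : ℝ)) (𝓝 1)) ∧
    (1 < c → Tendsto f (𝓝[>] (0 : ℝ)) (𝓝 (1 / c))) ∧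
    ((c < 1 ∨ 1 < c) →
      Tendsto f (𝓝[>] (0 : ℝ))
        (𝓝 (1 - (c - 1) / c * (if 1 < c then 1 else 0)))) := by
  have key : Tendsto f (𝓝[>] (0 : ℝ)) (𝓝 (1 - (|1 - c| - (1 - c)) / (2 * c))) := by
    have hcont : Continuous fun z : ℝ =>
        1 - (Real.sqrt ((1 - c + z) ^ 2 + 4 * c * z) - (1 - c + z)) / (2 * c) := by
      fun_prop
    have hlim := (hcont.tendsto 0).mono_left (nhdsWithin_le_nhds (s := Set.Ioi 0))
    simp only [add_zero, mul_zero, Real.sqrt_sq_eq_abs] at hlim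
    refine hlim.congr' ?_
    filter_upwards [self_mem_nhdsWithin] with z hz
    rw [hf, hm, return_coefficient_eq_rationalized hc hz]
  have below : c < 1 → Tendsto f (𝓝[>] (0 : ℝ)) (𝓝 1) := fun h => by
    simpa [abs_of_pos (sub_pos.2 h)] using key
  have above : 1 < c → Tendsto f (𝓝[>] (0 : ℝ)) (𝓝 (1 / c)) := fun h => by
    convert key using 2
    rw [abs_of_neg (sub_neg.2 h)]
    field_simp
    ring
  refine ⟨below, above, ?_⟩
  rintro (h | h)
  · simpa [h.not_gt] using below h
  · convert above h using 2
    rw [if_pos h]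
    field_simp
    ring
end

section
/- Let W ∈ ℝ^{p×d} and θ ∈ ℝ^d. The matrix I_d + WᵀW is symmetric positive definite, hence invertible; set β = W(I_d + WᵀW)⁻¹θ. (i) For all z ∈ ℝ^d, u ∈ ℝ^p, b ∈ ℝ, defining x = Wz + u and e = b + θᵀ(I_d + WᵀW)⁻¹(z − Wᵀu), one has xᵀβ + e = zᵀθ + b. (ii) If moreover z, u, b are mutually independent random elements with E[z] = 0, E[zzᵀ] = I_d, E[u] = 0, E[uuᵀ] = I_p, E[b] = 0 and E[b²] = σ_b², then E[e²] = σ_b² + θᵀ(I_d + WᵀW)⁻¹θ. -/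
open MeasureTheory ProbabilityTheory Matrix

namespace LatentSpace

section Algebra

variable {m n : Type*} [Fintype m] [Fintype n] [DecidableEq n]

theorem posDef_one_add_transpose_mul_self (W : Matrix m n ℝ) : (1 + Wᵀ * W).PosDef := by
  have h : (Wᵀ * W).PosSemidef := by
    simpa only [conjTranspose_eq_transpose_of_trivial] using posSemidef_conjTranspose_mul_self W
  exact PosDef.one.add_posSemidef h

theorem transpose_inv_one_add_transpose_mul_self (W : Matrix m n ℝ) :
    ((1 + Wᵀ * W)⁻¹)ᵀ = (1 + Wᵀ * W)⁻¹ := by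
  rw [transpose_nonsing_inv]
  simp

theorem inv_mulVec_add_transpose_mulVec (W : Matrix m n ℝ) (θ : n → ℝ) :
    (1 + Wᵀ * W)⁻¹ *ᵥ θ + Wᵀ *ᵥ (W *ᵥ ((1 + Wᵀ * W)⁻¹ *ᵥ θ)) = θ := by
  have hdet : IsUnit (1 + Wᵀ * W).det :=
    (isUnit_iff_isUnit_det _).mp (posDef_one_add_transpose_mul_self W).isUnit
  calc
    _ = (1 + Wᵀ * W) *ᵥ ((1 + Wᵀ * W)⁻¹ *ᵥ θ) := by
      rw [add_mulVec, one_mulVec, mulVec_mulVec _ Wᵀ W]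
    _ = θ := by rw [mulVec_mulVec, mul_nonsing_inv _ hdet, one_mulVec]

theorem dotProduct_inv_mulVec_sub (W : Matrix m n ℝ) (θ z : n → ℝ) (u : m → ℝ) :
    θ ⬝ᵥ ((1 + Wᵀ * W)⁻¹ *ᵥ (z - Wᵀ *ᵥ u)) =
      ((1 + Wᵀ * W)⁻¹ *ᵥ θ) ⬝ᵥ z - (W *ᵥ ((1 + Wᵀ * W)⁻¹ *ᵥ θ)) ⬝ᵥ u := by
  rw [dotProduct_mulVec, ← mulVec_transpose, transpose_inv_one_add_transpose_mul_self,
    dotProduct_sub, dotProduct_mulVec _ Wᵀ u, vecMul_transpose]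

end Algebra

section Moments

variable {Ω ι : Type*} [MeasurableSpace Ω] {μ : Measure Ω} [Fintype ι] {X : Ω → ι → ℝ}

theorem memLp_two_dotProduct (hX : ∀ i, Integrable (fun ω => X ω i) μ)
    (hX2 : ∀ i j, Integrable (fun ω => X ω i * X ω j) μ) (a : ι → ℝ) :
    MemLp (fun ω => a ⬝ᵥ X ω) 2 μ := by
  refine memLp_finsetSum _ fun i _ => MemLp.const_mul ?_ (a i)
  rw [memLp_two_iff_integrable_sq (hX i).aestronglyMeasurable]
  simpa only [sq] using hX2 i i

theorem integral_dotProduct_eq_zero (hX : ∀ i, Integrable (fun ω => X ω i) μ)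
    (hmean : ∀ i, ∫ ω, X ω i ∂μ = 0) (a : ι → ℝ) : ∫ ω, a ⬝ᵥ X ω ∂μ = 0 := by
  simp only [dotProduct]
  rw [integral_finsetSum _ fun i _ => (hX i).const_mul (a i)]
  simp [integral_const_mul, hmean]

theorem integral_sq_dotProduct [DecidableEq ι]
    (hX2 : ∀ i j, Integrable (fun ω => X ω i * X ω j) μ)
    (hcov : ∀ i j, ∫ ω, X ω i * X ω j ∂μ = if i = j then (1 : ℝ) else 0) (a : ι → ℝ) :
    ∫ ω, (a ⬝ᵥ X ω) ^ 2 ∂μ = a ⬝ᵥ a := by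
  have hexp : ∀ ω, (a ⬝ᵥ X ω) ^ 2 = ∑ i, ∑ j, a i * a j * (X ω i * X ω j) := fun ω => by
    rw [sq, dotProduct, Finset.sum_mul_sum]
    exact Finset.sum_congr rfl fun i _ => Finset.sum_congr rfl fun j _ => by ring
  simp only [hexp]
  rw [integral_finsetSum _ fun i _ => integrable_finsetSum _ fun j _ => (hX2 i j).const_mul _]
  refine Finset.sum_congr rfl fun i _ => ?_
  rw [integral_finsetSum _ fun j _ => (hX2 i j).const_mul _]
  simp [integral_const_mul, hcov]

theorem integral_sq_add_of_indepFun [IsProbabilityMeasure μ] {Y V : Ω → ℝ} (hY : MemLp Y 2 μ)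
    (hV : MemLp V 2 μ) (hY0 : ∫ ω, Y ω ∂μ = 0) (hV0 : ∫ ω, V ω ∂μ = 0) (h : IndepFun Y V μ) :
    ∫ ω, (Y ω + V ω) ^ 2 ∂μ = ∫ ω, Y ω ^ 2 ∂μ + ∫ ω, V ω ^ 2 ∂μ := by
  have hsum : ∫ ω, (Y + V) ω ∂μ = 0 := by
    simp only [Pi.add_apply]
    rw [integral_add (hY.integrable one_le_two) (hV.integrable one_le_two), hY0, hV0, add_zero]
  have hvar := h.variance_add hY hV
  rwa [variance_of_integral_eq_zero (hY.add hV).aemeasurable hsum,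
    variance_of_integral_eq_zero hY.aemeasurable hY0,
    variance_of_integral_eq_zero hV.aemeasurable hV0] at hvar

end Moments

end LatentSpace

open LatentSpace

/-- The latent space model `y = zᵀθ + b`, with observed features `x = Wz + u`,
is a special case of the linear model `y = xᵀβ + e` with
`β = W(I + WᵀW)⁻¹θ`, and the noise variance is `σ_b² + θᵀ(I + WᵀW)⁻¹θ`. -/
theorem latent_space_model_rewriting
    {Ω : Type*} [MeasurableSpace Ω] (μ : Measure Ω) [IsProbabilityMeasure μ]
    {p d : ℕ} (W : Matrix (Fin p) (Fin d) ℝ) (θ : Fin d → ℝ)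
    (β : Fin p → ℝ) (hβ : β = (W * (1 + Wᵀ * W)⁻¹) *ᵥ θ)
    -- the random elements of the latent model
    (Z : Ω → Fin d → ℝ) (U : Ω → Fin p → ℝ) (B : Ω → ℝ) (σb : ℝ)
    (hZU_indep : IndepFun Z U μ)
    (hZUB_indep : IndepFun (fun ω => (Z ω, U ω)) B μ)
    (hZ_int : ∀ i, Integrable (fun ω => Z ω i) μ)
    (hZ_mean : ∀ i, ∫ ω, Z ω i ∂μ = 0)
    (hZ_int2 : ∀ i j, Integrable (fun ω => Z ω i * Z ω j) μ)
    (hZ_cov : ∀ i j, ∫ ω, Z ω i * Z ω j ∂μ = if i = j then (1 : ℝ) else 0)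
    (hU_int : ∀ i, Integrable (fun ω => U ω i) μ)
    (hU_mean : ∀ i, ∫ ω, U ω i ∂μ = 0)
    (hU_int2 : ∀ i j, Integrable (fun ω => U ω i * U ω j) μ)
    (hU_cov : ∀ i j, ∫ ω, U ω i * U ω j ∂μ = if i = j then (1 : ℝ) else 0)
    (hB_int : Integrable B μ) (hB_mean : ∫ ω, B ω ∂μ = 0)
    (hB_int2 : Integrable (fun ω => (B ω) ^ 2) μ)
    (hB_var : ∫ ω, (B ω) ^ 2 ∂μ = σb ^ 2) :
    -- `I + WᵀW` is positive definite (hence invertible)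
    (1 + Wᵀ * W).PosDef ∧
    -- (i) the pointwise rewriting of the model
    (∀ (zv : Fin d → ℝ) (u : Fin p → ℝ) (b : ℝ),
      (W *ᵥ zv + u) ⬝ᵥ β +
          (b + θ ⬝ᵥ ((1 + Wᵀ * W)⁻¹ *ᵥ (zv - Wᵀ *ᵥ u))) =
        zv ⬝ᵥ θ + b) ∧
    -- (ii) the variance of the induced noise
    (∫ ω, (B ω + θ ⬝ᵥ ((1 + Wᵀ * W)⁻¹ *ᵥ (Z ω - Wᵀ *ᵥ U ω))) ^ 2 ∂μ =
      σb ^ 2 + θ ⬝ᵥ ((1 + Wᵀ * W)⁻¹ *ᵥ θ)) := by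
  refine ⟨posDef_one_add_transpose_mul_self W, fun zv u b => ?_, ?_⟩
  · have hβ' : β = W *ᵥ ((1 + Wᵀ * W)⁻¹ *ᵥ θ) := by rw [hβ, mulVec_mulVec]
    have hθ := congrArg (zv ⬝ᵥ ·) (inv_mulVec_add_transpose_mulVec W θ)
    simp only [dotProduct_add, ← hβ', dotProduct_mulVec zv Wᵀ β, vecMul_transpose] at hθ
    rw [dotProduct_inv_mulVec_sub, ← hβ', add_dotProduct, dotProduct_comm _ zv,
      dotProduct_comm β u]
    linarith
  · simp only [dotProduct_inv_mulVec_sub]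
    set a := (1 + Wᵀ * W)⁻¹ *ᵥ θ with ha
    set c := W *ᵥ a with hc
    have hac : a ⬝ᵥ a + c ⬝ᵥ c = θ ⬝ᵥ a := by
      have hθ := congrArg (a ⬝ᵥ ·) (inv_mulVec_add_transpose_mulVec W θ)
      simp only [← ha, ← hc, dotProduct_add, dotProduct_mulVec a Wᵀ c, vecMul_transpose] at hθ
      rw [hθ, dotProduct_comm]
    have hZ := memLp_two_dotProduct hZ_int hZ_int2 a
    have hU := memLp_two_dotProduct hU_int hU_int2 (-c)
    have hB : MemLp B 2 μ := (memLp_two_iff_integrable_sq hB_int.aestronglyMeasurable).mpr hB_int2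
    have hZ0 := integral_dotProduct_eq_zero hZ_int hZ_mean a
    have hU0 := integral_dotProduct_eq_zero hU_int hU_mean (-c)
    have hmeas_dot {k : ℕ} (v : Fin k → ℝ) : Measurable fun x : Fin k → ℝ => v ⬝ᵥ x := by
      unfold dotProduct
      fun_prop
    have hindep : IndepFun (fun ω => a ⬝ᵥ Z ω) (fun ω => -c ⬝ᵥ U ω) μ :=
      hZU_indep.comp (hmeas_dot a) (hmeas_dot (-c))
    have hindepB : IndepFun B (fun ω => a ⬝ᵥ Z ω + -c ⬝ᵥ U ω) μ :=
      (hZUB_indep.comp (((hmeas_dot a).comp measurable_fst).add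
        ((hmeas_dot (-c)).comp measurable_snd)) measurable_id).symm
    have hZU : MemLp (fun ω => a ⬝ᵥ Z ω + -c ⬝ᵥ U ω) 2 μ := hZ.add hU
    have hsum0 : ∫ ω, a ⬝ᵥ Z ω + -c ⬝ᵥ U ω ∂μ = 0 := by
      rw [integral_add (hZ.integrable one_le_two) (hU.integrable one_le_two), hZ0, hU0, add_zero]
    calc
      _ = ∫ ω, (B ω + (a ⬝ᵥ Z ω + -c ⬝ᵥ U ω)) ^ 2 ∂μ := by
        simp only [neg_dotProduct, sub_eq_add_neg]
      _ = σb ^ 2 + (a ⬝ᵥ a + c ⬝ᵥ c) := by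
        rw [integral_sq_add_of_indepFun hB hZU hB_mean hsum0 hindepB, hB_var,
          integral_sq_add_of_indepFun hZ hU hZ0 hU0 hindep,
          integral_sq_dotProduct hZ_int2 hZ_cov, integral_sq_dotProduct hU_int2 hU_cov,
          neg_dotProduct_neg]
      _ = _ := by rw [hac]
end

section
/- For c > 0 and z > 0, define m(z; c) = (c − 1 − z + √((1 − c + z)² + 4cz)) / (2cz). Then for every fixed c > 0 the function t ↦ m(t; c) is differentiable at each z > 0 with derivative equal to −(1 + c·m(z; c)) / ( (1 − c + cz·m(z; c) + z)² + cz ); in particular this derivative is nonpositive, so z ↦ m(z; c) is nonincreasing on (0, ∞). -/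
/-- Derivative of the Marchenko–Pastur Stieltjes transform in the ridge
penalty: `m′(z) = −(1 + c·m(z)) / ((1 − c + cz·m(z) + z)² + cz)`, which is
nonpositive, so `z ↦ m(z; c)` is nonincreasing on `(0, ∞)`. -/
theorem stieltjes_transform_hasDerivAt (c : ℝ) (hc : 0 < c) (m : ℝ → ℝ)
    (hm : ∀ z, m z = (c - 1 - z + Real.sqrt ((1 - c + z) ^ 2 + 4 * c * z)) /
        (2 * c * z)) :
    (∀ z : ℝ, 0 < z →
      HasDerivAt m
        (-(1 + c * m z) / ((1 - c + c * z * m z + z) ^ 2 + c * z)) z) ∧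
    (∀ z : ℝ, 0 < z →
      -(1 + c * m z) / ((1 - c + c * z * m z + z) ^ 2 + c * z) ≤ 0) ∧
    AntitoneOn m (Set.Ioi (0 : ℝ)) := by
  have root : ∀ z : ℝ, 0 < z → ∃ s : ℝ, s = Real.sqrt ((1 - c + z) ^ 2 + 4 * c * z) ∧ 0 < s ∧
      s ^ 2 = (1 - c + z) ^ 2 + 4 * c * z ∧ 0 < s + (1 - c + z) ∧ 0 < s - (1 - c + z) := by
    intro z hz
    have hcz : 0 < c * z := mul_pos hc hz
    have hR : 0 < (1 - c + z) ^ 2 + 4 * c * z := by nlinarith [sq_nonneg (1 - c + z)]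
    have habs : |1 - c + z| < Real.sqrt ((1 - c + z) ^ 2 + 4 * c * z) :=
      Real.lt_sqrt_of_sq_lt (by rw [sq_abs]; linarith)
    obtain ⟨h₁, h₂⟩ := abs_lt.mp habs
    exact ⟨_, rfl, Real.sqrt_pos.mpr hR, Real.sq_sqrt hR.le, by linarith, by linarith⟩
  have hderiv : ∀ z : ℝ, 0 < z →
      HasDerivAt m (-(1 + c * m z) / ((1 - c + c * z * m z + z) ^ 2 + c * z)) z := by
    intro z hz
    obtain ⟨s, hs, hs0, hsq, hadd, -⟩ := root z hz
    have hR : (1 - c + z) ^ 2 + 4 * c * z ≠ 0 := by rw [← hsq]; positivity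
    have hrad : HasDerivAt (fun t : ℝ => (1 - c + t) ^ 2 + 4 * c * t)
        (2 * (1 - c + z) + 4 * c) z := by
      refine ((((hasDerivAt_id' z).const_add (1 - c)).pow 2).add
        ((hasDerivAt_id' z).const_mul (4 * c))).congr_deriv ?_
      norm_num
    have hnum := ((hasDerivAt_id' z).const_sub (c - 1)).add (hrad.sqrt hR)
    have hquot := hnum.div ((hasDerivAt_id' z).const_mul (2 * c)) (by positivity)
    have hden : (1 - c + c * z * m z + z) ^ 2 + c * z = s * (s + (1 - c + z)) / 2 := by
      have hczm : c * z * m z = (s - (1 - c + z)) / 2 := by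
        rw [hm, ← hs]
        field_simp
        ring
      rw [hczm]
      linear_combination (-1 / 4) * hsq
    rw [hden, hm z, ← hs]
    rw [show m = _ from funext hm]
    refine hquot.congr_deriv ?_
    simp only [Pi.add_apply]
    rw [← hs]
    have hadd' := hadd.ne'
    field_simp
    linear_combination (-2 * (z + s)) * hsq
  have hnonpos : ∀ z : ℝ, 0 < z →
      -(1 + c * m z) / ((1 - c + c * z * m z + z) ^ 2 + c * z) ≤ 0 := by
    intro z hz
    obtain ⟨s, hs, -, -, -, hsub⟩ := root z hz
    have hmz : 0 ≤ m z := by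
      rw [hm, ← hs]
      exact div_nonneg (by linarith) (by positivity)
    exact div_nonpos_of_nonpos_of_nonneg (neg_nonpos.mpr (by positivity)) (by positivity)
  refine ⟨hderiv, hnonpos, antitoneOn_of_hasDerivWithinAt_nonpos (convex_Ioi 0)
    (fun z hz => (hderiv z hz).continuousAt.continuousWithinAt)
    (fun z hz => (hderiv z (interior_subset hz)).hasDerivWithinAt)
    (fun z hz => hnonpos z (interior_subset hz))⟩
end
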